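/- Every x²-divisible polynomial g ∈ ℤ[x] of degree d ≥ 3 has rapidly increasing numerators on the finite set 𝕌_g^0. -/

import Mathlib

open Polynomial

/-- The `n`-th iterate of `g_c := g + c` applied to `0`, for `g ∈ ℤ[x]` and `c ∈ ℚ`. -/
noncomputable def gcIter (g : ℤ[X]) (c : ℚ) (n : ℕ) : ℚ :=
  (fun x : ℚ => (g.map (Int.castRingHom ℚ)).eval x + c)^[n] 0

/-- `g` is `x²`-divisible: degree at least 2 and zero constant and linear coefficients. -/
def IsX2Divisible (g : ℤ[X]) : Prop :=
  2 ≤ g.natDegree ∧ g.coeff 0 = 0 ∧ g.coeff 1 = 0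

/-- The length `L_g = 1 + ∑_{i=2}^{d-1} |u_i|/|u_d|` of an `x²`-divisible polynomial. -/
noncomputable def Lg (g : ℤ[X]) : ℝ :=
  1 + ∑ i ∈ Finset.Ico 2 g.natDegree, (|g.coeff i| : ℝ) / (|g.leadingCoeff| : ℝ)

/-- `S_g`: the set of `c ∈ ℚ` such that the sequence `{g_c^n(0)}_{n ≥ 1}` takes
infinitely many values. -/
def Sg (g : ℤ[X]) : Set ℚ :=
  {c : ℚ | (Set.range fun n : ℕ => gcIter g c (n + 1)).Infinite}

/-- The numerator `A_n` of `g_c^{n+1}(0) = g_c^n(c) = A_n / B_n` in lowest terms. -/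
noncomputable def An (g : ℤ[X]) (c : ℚ) (n : ℕ) : ℤ := (gcIter g c (n + 1)).num

/-- The (positive) denominator `B_n` of `g_c^{n+1}(0) = g_c^n(c) = A_n / B_n`
in lowest terms. -/
noncomputable def Bn (g : ℤ[X]) (c : ℚ) (n : ℕ) : ℕ := (gcIter g c (n + 1)).den

/-- For a natural number `a`, the factor `â = ∏_{p ∈ I(a)} p^{val_p(a)}`, where
`I(a)` consists of the primes `p` with `val_p(a) > val_p(u_d)`. -/
noncomputable def hatB (g : ℤ[X]) (a : ℕ) : ℕ :=
  ∏ p ∈ a.primeFactors.filter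
      (fun p => padicValInt p g.leadingCoeff < padicValNat p a),
    p ^ padicValNat p a

/-- `g` has rapidly increasing numerators on `S`: there is an integer `N > 0` such that
for every `c ∈ S` there is a finite set `J_c ⊆ ℕ` with `#J_c ≤ N` such that for every
`n ≥ 1` outside `J_c` one has `ln |A_n| > ∑_{p ∣ n} ln |A_{n/p}|`. -/
def RapidlyIncreasingNumerators (g : ℤ[X]) (S : Set ℚ) : Prop :=
  ∃ N : ℕ, 0 < N ∧ ∀ c ∈ S, ∃ J : Finset ℕ, J.card ≤ N ∧
    ∀ n : ℕ, 1 ≤ n → n ∉ J →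
      (∑ p ∈ n.primeFactors, Real.log |(An g c (n / p) : ℝ)|) <
        Real.log |(An g c n : ℝ)|

/-- `𝕌_g⁰`: the set of `c ∈ S_g ∩ [−4L_g, 4L_g]` whose reduced denominator divides
the leading coefficient `u_d`. -/
def Ug0 (g : ℤ[X]) : Set ℚ :=
  {c : ℚ | c ∈ Sg g ∧ |(c : ℝ)| ≤ 4 * Lg g ∧ (c.den : ℤ) ∣ g.leadingCoeff}

open Filter Topology

theorem AbsoluteValue.exists_pow_le_eval (v : AbsoluteValue ℚ ℝ) (P : ℚ[X])
    (hP : 1 ≤ P.natDegree) :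
    ∃ R : ℝ, 2 ≤ R ∧ ∀ x, R ≤ v x → v x ^ (P.natDegree - 1) ≤ v (P.eval x) := by
  obtain ⟨s, hs⟩ : ∃ s, P.natDegree = s + 1 := ⟨P.natDegree - 1, by omega⟩
  have hlc : 0 < v P.leadingCoeff := v.pos (by
    rw [Ne, leadingCoeff_eq_zero]; rintro rfl; simp at hP)
  set S : ℝ := ∑ i ∈ Finset.range (s + 1), v (P.coeff i)
  refine ⟨max 2 ((1 + S) / v P.leadingCoeff), le_max_left _ _, fun x hx => ?_⟩
  have h2 : 2 ≤ v x := (le_max_left _ _).trans hx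
  have h3 : 1 + S ≤ v x * v P.leadingCoeff :=
    (div_le_iff₀ hlc).1 ((le_max_right _ _).trans hx)
  have hlow : v (∑ i ∈ Finset.range (s + 1), P.coeff i * x ^ i) ≤ S * v x ^ s := by
    refine (v.sum_le _ _).trans ?_
    rw [Finset.sum_mul]
    refine Finset.sum_le_sum fun i hi => ?_
    rw [v.map_mul, v.map_pow]
    have : i ≤ s := by have := Finset.mem_range.1 hi; omega
    exact mul_le_mul_of_nonneg_left (pow_le_pow_right₀ (by linarith) this) (v.nonneg _)
  have hlead : v (P.leadingCoeff * x ^ (s + 1)) = v P.leadingCoeff * v x ^ (s + 1) := by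
    rw [v.map_mul, v.map_pow]
  have hsum : P.eval x =
      P.leadingCoeff * x ^ (s + 1) + ∑ i ∈ Finset.range (s + 1), P.coeff i * x ^ i := by
    rw [eval_eq_sum_range, hs, Finset.sum_range_succ, ← hs, coeff_natDegree, add_comm]
  have htri : v (P.leadingCoeff * x ^ (s + 1)) ≤
      v (P.eval x) + v (∑ i ∈ Finset.range (s + 1), P.coeff i * x ^ i) := by
    have := v.sub_le_add (P.eval x) (∑ i ∈ Finset.range (s + 1), P.coeff i * x ^ i)
    rwa [hsum, add_sub_cancel_right, ← hsum] at this
  have hpos : (0 : ℝ) ≤ v x ^ s := by positivity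
  rw [hs, Nat.add_sub_cancel]
  have := mul_le_mul_of_nonneg_right h3 hpos
  rw [hlead, pow_succ] at htri
  nlinarith

theorem AbsoluteValue.exists_growth_of_unbounded (v : AbsoluteValue ℚ ℝ) (P : ℚ[X])
    (hP : 2 ≤ P.natDegree)
    (hunb : ∀ R : ℝ, ∃ n, R < v ((fun x => P.eval x)^[n] 0)) :
    ∃ κ : ℝ, 0 < κ ∧ ∀ᶠ n in atTop,
      κ * ((P.natDegree - 1 : ℕ) : ℝ) ^ n ≤ Real.log (v ((fun x => P.eval x)^[n] 0)) := by
  obtain ⟨R, hR2, hR⟩ := v.exists_pow_le_eval P (by omega)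
  set s := P.natDegree - 1
  have hs : 1 ≤ s := by omega
  obtain ⟨m, hm⟩ := hunb R
  have key : ∀ k, R ^ (s ^ k) ≤ v ((fun x => P.eval x)^[m + k] 0) := by
    intro k
    induction k with
    | zero => simpa using hm.le
    | succ k ih =>
      have h1 : R ≤ v ((fun x => P.eval x)^[m + k] 0) :=
        (le_self_pow₀ (by linarith) (by positivity)).trans ih
      rw [← add_assoc, Function.iterate_succ_apply']
      refine le_trans ?_ (hR _ h1)
      rw [pow_succ, pow_mul]
      exact pow_le_pow_left₀ (by positivity) ih _
  have hlog : 0 < Real.log R := Real.log_pos (by linarith)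
  have hs0 : (0 : ℝ) < s := by exact_mod_cast hs
  refine ⟨Real.log R / (s : ℝ) ^ m, by positivity, eventually_atTop.2 ⟨m, fun n hn => ?_⟩⟩
  obtain ⟨k, rfl⟩ := Nat.exists_eq_add_of_le hn
  have := Real.log_le_log (by positivity) (key k)
  rw [Real.log_pow] at this
  refine le_trans (le_of_eq ?_) this
  push_cast
  rw [pow_add]
  field_simp

theorem Rat.padic_le_den (p : ℕ) [Fact p.Prime] (x : ℚ) :
    Rat.AbsoluteValue.padic p x ≤ x.den := by
  rw [Rat.AbsoluteValue.padic_eq_padicNorm]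
  have h1 : padicNorm p x * padicNorm p (x.den : ℚ) = padicNorm p (x.num : ℚ) := by
    rw [← padicNorm.mul, Rat.mul_den_eq_num]
  have h2 : padicNorm p (x.num : ℚ) ≤ 1 := padicNorm.of_int _
  have h3 : (1 : ℚ) ≤ padicNorm p (x.den : ℚ) * x.den := by
    rw [padicNorm.eq_zpow_of_nonzero (by exact_mod_cast x.den_nz), padicValRat.of_nat,
      zpow_neg, zpow_natCast, inv_mul_eq_div, one_le_div
        (by have := (Fact.out : p.Prime).pos; positivity)]
    exact_mod_cast Nat.le_of_dvd x.den_pos pow_padicValNat_dvd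
  have : padicNorm p x ≤ x.den := by
    have h0 := padicNorm.nonneg (p := p) x
    have hd : (0 : ℚ) ≤ x.den := by positivity
    nlinarith
  exact_mod_cast this

theorem Rat.pow_factorization_den_eq_padic (p : ℕ) [Fact p.Prime] (x : ℚ) (hp : p ∣ x.den) :
    ((p ^ x.den.factorization p : ℕ) : ℝ) = Rat.AbsoluteValue.padic p x := by
  rw [Rat.AbsoluteValue.padic_eq_padicNorm]
  have h1 : padicNorm p x * padicNorm p (x.den : ℚ) = padicNorm p (x.num : ℚ) := by
    rw [← padicNorm.mul, Rat.mul_den_eq_num]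
  have h2 : padicNorm p (x.num : ℚ) = 1 := by
    rw [padicNorm.int_eq_one_iff]
    intro h
    have := Nat.dvd_gcd (Int.natCast_dvd.1 h) hp
    rw [x.reduced] at this
    exact (Fact.out : p.Prime).one_lt.ne' (Nat.dvd_one.1 this)
  have hp0 : (p : ℚ) ≠ 0 := by exact_mod_cast (Fact.out : p.Prime).ne_zero
  have hden : (x.den : ℚ) ≠ 0 := by exact_mod_cast x.den_nz
  rw [h2, padicNorm.eq_zpow_of_nonzero hden, padicValRat.of_nat,
      zpow_neg, zpow_natCast, mul_inv_eq_one₀ (pow_ne_zero _ hp0)] at h1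
  rw [h1, Nat.factorization_def _ Fact.out]
  push_cast
  rfl

theorem Rat.finite_abs_le_den_le (R : ℝ) (D : ℕ) :
    {x : ℚ | |(x : ℝ)| ≤ R ∧ x.den ≤ D}.Finite := by
  refine (((Set.finite_Icc (-⌈R * D⌉) ⌈R * D⌉).prod (Set.finite_Iic D)).image
    fun y : ℤ × ℕ => (y.1 : ℚ) / y.2).subset ?_
  rintro x ⟨h1, h2⟩
  refine ⟨(x.num, x.den), ⟨?_, h2⟩, x.num_div_den⟩
  have hnum : |(x.num : ℝ)| ≤ R * D := by
    have : (x.num : ℝ) = x * x.den := by exact_mod_cast (Rat.mul_den_eq_num x).symm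
    rw [this, abs_mul, Nat.abs_cast]
    have hR : 0 ≤ R := (abs_nonneg _).trans h1
    exact mul_le_mul h1 (by exact_mod_cast h2) (by positivity) hR
  have := (abs_le.1 (hnum.trans (Int.le_ceil _)))
  exact ⟨by exact_mod_cast this.1, by exact_mod_cast this.2⟩

theorem exists_lipschitz_of_coeff_one_eq_zero (P : ℝ[X]) (hP : P.coeff 1 = 0) (M : ℝ)
    (hM : 0 ≤ M) :
    ∃ Λ : ℝ, 2 ≤ Λ ∧
      (∀ x y, |x| ≤ M → |y| ≤ M → |P.eval x - P.eval y| ≤ Λ * |x - y|) ∧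
      ∀ ρ ≤ M, ∀ x y, |x| ≤ ρ → |y| ≤ ρ → |P.eval x - P.eval y| ≤ Λ * ρ * |x - y| := by
  obtain ⟨Q, hQ⟩ : X ∣ derivative P := by
    rw [X_dvd_iff, coeff_derivative]; simp [hP]
  obtain ⟨B, hB⟩ := (isCompact_closedBall (0 : ℝ) M).exists_bound_of_continuousOn
    (f := fun t => Q.eval t) Q.continuous.continuousOn
  have hB0 : 0 ≤ B := (norm_nonneg _).trans (hB 0 (by simpa using hM))
  have key : ∀ ρ ≤ M, ∀ x y, |x| ≤ ρ → |y| ≤ ρ →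
      |P.eval x - P.eval y| ≤ ρ * B * |x - y| := by
    intro ρ hρ x y hx hy
    refine (convex_closedBall (0 : ℝ) ρ).norm_image_sub_le_of_norm_deriv_le
      (f := fun t => P.eval t) (fun t _ => P.differentiableAt) (fun t ht => ?_)
      (by simpa using hy) (by simpa using hx)
    have ht' : ‖t‖ ≤ ρ := by simpa using ht
    rw [Polynomial.deriv, hQ, eval_mul, eval_X, norm_mul]
    exact mul_le_mul ht' (hB t (by simpa using ht'.trans hρ)) (norm_nonneg _)
      ((norm_nonneg _).trans ht')
  refine ⟨max 2 (max B (M * B)), le_max_left _ _, fun x y hx hy => ?_,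
    fun ρ hρ x y hx hy => ?_⟩
  · refine (key M le_rfl x y hx hy).trans (mul_le_mul_of_nonneg_right ?_ (abs_nonneg _))
    exact (le_max_right _ _).trans (le_max_right _ _)
  · refine (key ρ hρ x y hx hy).trans (mul_le_mul_of_nonneg_right ?_ (abs_nonneg _))
    rw [mul_comm]
    exact mul_le_mul_of_nonneg_right ((le_max_left _ _).trans (le_max_right _ _))
      ((abs_nonneg _).trans hx)

/-- If the orbit of the critical point `0` returns very close to `0`, then it is attracted to
a periodic point. -/
theorem exists_tendsto_isPeriodicPt (f : ℝ → ℝ) (hf : Continuous f) {M Λ : ℝ}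
    (hM : ∀ n, |f^[n] 0| ≤ M) (hΛ : 2 ≤ Λ)
    (hlip : ∀ x y, |x| ≤ M + 1 → |y| ≤ M + 1 → |f x - f y| ≤ Λ * |x - y|)
    (hcrit : ∀ ρ ≤ M + 1, ∀ x y, |x| ≤ ρ → |y| ≤ ρ → |f x - f y| ≤ Λ * ρ * |x - y|)
    {n : ℕ} (hn : 1 ≤ n) (hsmall : |f^[n] 0| ≤ (Λ ^ n)⁻¹ / 4) :
    ∃ z, Function.IsPeriodicPt f n z ∧ Tendsto (fun k => f^[k * n] 0) atTop (𝓝 z) := by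
  have hM0 : 0 ≤ M := by simpa using hM 0
  set r : ℝ := (Λ ^ n)⁻¹ / 2 with hr
  have hΛn : 1 ≤ Λ ^ n := one_le_pow₀ (by linarith)
  have hr0 : 0 < r := by positivity
  have hr1 : r ≤ 1 := by
    have : (Λ ^ n)⁻¹ ≤ 1 := inv_le_one_of_one_le₀ hΛn
    linarith
  have hΛr : Λ ^ n * r = 1 / 2 := by rw [hr]; field_simp
  have near : ∀ k, 1 ≤ k → k ≤ n → ∀ x y, |x| ≤ r → |y| ≤ r →
      |f^[k] x - f^[k] y| ≤ Λ ^ k * r * |x - y| := by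
    intro k hk
    induction k, hk using Nat.le_induction with
    | base =>
      intro _ x y hx hy
      simpa using hcrit r (by linarith) x y hx hy
    | succ k hk ih =>
      intro hkn x y hx hy
      have bound : ∀ x, |x| ≤ r → |f^[k] x| ≤ M + 1 := by
        intro x hx
        have h1 := ih (by omega) x 0 hx (by simpa using hr0.le)
        have h2 : Λ ^ k * r ≤ 1 / 2 := by
          rw [← hΛr]
          exact mul_le_mul_of_nonneg_right
            (pow_le_pow_right₀ (by linarith) (by omega)) hr0.le
        have h3 : Λ ^ k * r * |x - 0| ≤ 1 / 2 * 1 := by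
          refine mul_le_mul h2 ?_ (abs_nonneg _) (by norm_num)
          simpa using hx.trans hr1
        have h4 := abs_sub_abs_le_abs_sub (f^[k] x) (f^[k] 0)
        have := hM k
        linarith
      rw [Function.iterate_succ_apply', Function.iterate_succ_apply']
      refine (hlip _ _ (bound x hx) (bound y hy)).trans ?_
      rw [pow_succ', mul_assoc, mul_assoc]
      refine mul_le_mul_of_nonneg_left ?_ (by linarith)
      rw [← mul_assoc]
      exact ih (by omega) x y hx hy
  have contr : ∀ x y, |x| ≤ r → |y| ≤ r → |f^[n] x - f^[n] y| ≤ 1 / 2 * |x - y| := by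
    intro x y hx hy
    rw [← hΛr]
    exact near n hn le_rfl x y hx hy
  have maps : ∀ x, |x| ≤ r → |f^[n] x| ≤ r := by
    intro x hx
    have h1 := contr x 0 hx (by simpa using hr0.le)
    rw [sub_zero] at h1
    have h2 := abs_sub_abs_le_abs_sub (f^[n] x) (f^[n] 0)
    linarith
  have step : ∀ k, f^[(k + 1) * n] 0 = f^[n] (f^[k * n] 0) := by
    intro k
    rw [← Function.iterate_add_apply, add_mul, one_mul, add_comm]
  have inball : ∀ k, |f^[k * n] 0| ≤ r := by
    intro k
    induction k with
    | zero => simpa using hr0.le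
    | succ k ih => rw [step]; exact maps _ ih
  have hdist : ∀ k, dist (f^[k * n] 0) (f^[(k + 1) * n] 0) ≤ r * (1 / 2) ^ k := by
    intro k
    induction k with
    | zero => simpa [Real.dist_eq] using inball 1
    | succ k ih =>
      rw [step (k + 1), Real.dist_eq]
      nth_rewrite 1 [step k]
      refine (contr _ _ (inball _) (inball _)).trans ?_
      rw [Real.dist_eq] at ih
      rw [pow_succ]
      linarith
  obtain ⟨z, hz⟩ := cauchySeq_tendsto_of_complete
    (cauchySeq_of_le_geometric (1 / 2 : ℝ) r (by norm_num) hdist)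
  refine ⟨z, ?_, hz⟩
  have h1 : Tendsto (fun k => f^[(k + 1) * n] 0) atTop (𝓝 z) :=
    hz.comp (tendsto_add_atTop_nat 1)
  have h2 : Tendsto (fun k => f^[(k + 1) * n] 0) atTop (𝓝 (f^[n] z)) := by
    simp_rw [step]
    exact ((hf.iterate n).tendsto z).comp hz
  exact tendsto_nhds_unique h2 h1

theorem eventually_lt_abs_iterate_of_bounded (P : ℝ[X]) (hP : P.coeff 1 = 0) {M : ℝ}
    (hM : ∀ n, |(fun x => P.eval x)^[n] 0| ≤ M)
    (hper : ∀ n, 1 ≤ n → (fun x => P.eval x)^[n] 0 ≠ 0) :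
    ∃ Λ : ℝ, 2 ≤ Λ ∧ ∀ᶠ n in atTop, (Λ ^ n)⁻¹ / 4 < |(fun x => P.eval x)^[n] 0| := by
  set f : ℝ → ℝ := fun x => P.eval x
  have hM0 : 0 ≤ M := by simpa using hM 0
  obtain ⟨Λ, hΛ, hlip, hcrit⟩ :=
    exists_lipschitz_of_coeff_one_eq_zero P hP (M + 1) (by linarith)
  refine ⟨Λ, hΛ, ?_⟩
  by_contra hcon
  have hcon' : ∃ᶠ n in atTop, |f^[n] 0| ≤ (Λ ^ n)⁻¹ / 4 := by
    simpa [Filter.Frequently] using hcon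
  apply hcon
  obtain ⟨n, hn, hsmall⟩ := frequently_atTop.1 hcon' 1
  obtain ⟨z, hz, hlim⟩ :=
    exists_tendsto_isPeriodicPt f P.continuous hM hΛ hlip hcrit hn hsmall
  have hzero : Tendsto (fun m : ℕ => (Λ ^ m)⁻¹ / 4) atTop (𝓝 0) := by
    simpa using
      (tendsto_inv_atTop_zero.comp (tendsto_pow_atTop_atTop_of_one_lt
        (by linarith : 1 < Λ))).div_const 4
  have hres : ∀ j ∈ Finset.range n, ∀ᶠ k in atTop,
      (Λ ^ (j + k * n))⁻¹ / 4 < |f^[j + k * n] 0| := by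
    intro j _
    have hne : f^[j] z ≠ 0 := by
      intro h0
      apply hper n hn
      rw [← h0, ← Function.iterate_add_apply, add_comm, Function.iterate_add_apply, hz.eq]
    have h1 : Tendsto (fun k => |f^[j + k * n] 0|) atTop (𝓝 |f^[j] z|) := by
      simp_rw [Function.iterate_add_apply]
      exact (((P.continuous.iterate j).tendsto z).comp hlim).abs
    have h2 : Tendsto (fun k : ℕ => j + k * n) atTop atTop :=
      tendsto_atTop_mono (fun k => show k ≤ j + k * n by nlinarith) tendsto_id
    exact (hzero.comp h2).eventually_lt h1 (abs_pos.2 hne)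
  obtain ⟨K, hK⟩ := eventually_atTop.1 ((eventually_all_finset _).2 hres)
  refine eventually_atTop.2 ⟨K * n, fun m hm => ?_⟩
  have := hK (m / n) ((Nat.le_div_iff_mul_le hn).2 hm) (m % n)
    (Finset.mem_range.2 (Nat.mod_lt _ hn))
  rwa [mul_comm, Nat.mod_add_div] at this

theorem exists_pow_bounds_iterate (g : ℤ[X]) (c : ℚ) (hd : 2 ≤ g.natDegree) :
    ∃ T : ℝ, 1 ≤ T ∧ ∀ n, ∃ e, e + 1 ≤ g.natDegree ^ n ∧ |(gcIter g c n : ℝ)| ≤ T ^ e ∧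
      (gcIter g c n).den ∣ c.den ^ e := by
  set d := g.natDegree
  set S : ℝ := ∑ i ∈ Finset.range (d + 1), |(g.coeff i : ℝ)|
  have hS : 0 ≤ S := Finset.sum_nonneg fun _ _ => abs_nonneg _
  refine ⟨1 + S + |(c : ℝ)|, by linarith [abs_nonneg (c : ℝ)], fun n => ?_⟩
  set T := 1 + S + |(c : ℝ)|
  have hT : 1 ≤ T := by linarith [abs_nonneg (c : ℝ)]
  induction n with
  | zero => exact ⟨0, by simp, by simp [gcIter], by simp [gcIter]⟩
  | succ n ih =>
    obtain ⟨e, he, habs, hden⟩ := ih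
    have hsucc : gcIter g c (n + 1) =
        ∑ i ∈ Finset.range (d + 1), (g.coeff i : ℚ) * gcIter g c n ^ i + c := by
      rw [gcIter, Function.iterate_succ_apply', ← gcIter,
        eval_eq_sum_range' (n := d + 1) (Nat.lt_succ_of_le (natDegree_map_le))]
      simp
    refine ⟨d * e + 1, ?_, ?_, ?_⟩
    · rw [pow_succ]; nlinarith
    · rw [hsucc]
      push_cast
      have hTde : 1 ≤ T ^ (d * e) := one_le_pow₀ hT
      have h1 : |∑ i ∈ Finset.range (d + 1), (g.coeff i : ℝ) * (gcIter g c n : ℝ) ^ i| ≤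
          S * T ^ (d * e) := by
        refine (Finset.abs_sum_le_sum_abs _ _).trans ?_
        rw [Finset.sum_mul]
        refine Finset.sum_le_sum fun i hi => ?_
        rw [abs_mul, abs_pow]
        refine mul_le_mul_of_nonneg_left ?_ (abs_nonneg _)
        refine (pow_le_pow_left₀ (abs_nonneg _) habs i).trans ?_
        rw [← pow_mul, mul_comm]
        exact pow_le_pow_right₀ hT
          (Nat.mul_le_mul_right _ (Nat.lt_succ_iff.1 (Finset.mem_range.1 hi)))
      refine (abs_add_le _ _).trans ?_
      rw [pow_succ']
      have : |(c : ℝ)| ≤ |(c : ℝ)| * T ^ (d * e) :=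
        le_mul_of_one_le_right (abs_nonneg _) hTde
      have : T * T ^ (d * e) = T ^ (d * e) + S * T ^ (d * e) + |(c : ℝ)| * T ^ (d * e) := by
        ring
      linarith
    · set x := gcIter g c n
      set q := c.den
      have hq : (q : ℚ) ≠ 0 := by exact_mod_cast c.den_nz
      have hxe : x * (q : ℚ) ^ e ∈ (Int.castRingHom ℚ).range := by
        obtain ⟨k, hk⟩ := hden
        refine ⟨x.num * k, ?_⟩
        have : (q : ℚ) ^ e = x.den * k := by exact_mod_cast hk
        rw [this, ← mul_assoc, Rat.mul_den_eq_num]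
        simp
      have hqm : (q : ℚ) ∈ (Int.castRingHom ℚ).range := ⟨q, by simp⟩
      have hcq : c * q ∈ (Int.castRingHom ℚ).range := ⟨c.num, by
        rw [Rat.mul_den_eq_num]; simp⟩
      have hmem : gcIter g c (n + 1) * (q : ℚ) ^ (d * e + 1) ∈
          (Int.castRingHom ℚ).range := by
        rw [hsucc, add_mul, Finset.sum_mul]
        refine add_mem (sum_mem fun i hi => ?_) ?_
        · obtain ⟨j, hj⟩ := Nat.exists_eq_add_of_le
            (Nat.lt_succ_iff.1 (Finset.mem_range.1 hi))
          have : (g.coeff i : ℚ) * x ^ i * (q : ℚ) ^ (d * e + 1) =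
              (g.coeff i : ℚ) * (x * (q : ℚ) ^ e) ^ i * (q : ℚ) ^ (j * e + 1) := by
            rw [hj]; ring
          rw [this]
          exact mul_mem (mul_mem ⟨g.coeff i, by simp⟩ (pow_mem hxe _)) (pow_mem hqm _)
        · rw [pow_succ', ← mul_assoc]
          exact mul_mem hcq (pow_mem hqm _)
      obtain ⟨a, ha⟩ := hmem
      have hx : gcIter g c (n + 1) = Rat.divInt a ((q ^ (d * e + 1) : ℕ) : ℤ) := by
        rw [Rat.divInt_eq_div, eq_div_iff (by push_cast; positivity)]
        push_cast
        exact ha.symm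
      rw [hx]
      exact_mod_cast Rat.den_dvd a ((q ^ (d * e + 1) : ℕ) : ℤ)

theorem exists_log_abs_num_le (g : ℤ[X]) (c : ℚ) (hd : 2 ≤ g.natDegree) :
    ∃ K : ℝ, 0 ≤ K ∧ ∀ n,
      Real.log |((gcIter g c n).num : ℝ)| ≤ K * (g.natDegree : ℝ) ^ n := by
  obtain ⟨T, hT, h⟩ := exists_pow_bounds_iterate g c hd
  have hq : (1 : ℝ) ≤ c.den := by exact_mod_cast c.den_pos
  have hTq : 1 ≤ T * c.den := one_le_mul_of_one_le_of_one_le hT hq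
  refine ⟨Real.log (T * c.den), Real.log_nonneg hTq, fun n => ?_⟩
  obtain ⟨e, he, habs, hden⟩ := h n
  set x := gcIter g c n
  have hnum : (x.num : ℝ) = x * x.den := by exact_mod_cast (Rat.mul_den_eq_num x).symm
  have hle : |(x.num : ℝ)| ≤ (T * c.den) ^ (g.natDegree ^ n) := by
    rw [hnum, abs_mul, Nat.abs_cast]
    have hden' : (x.den : ℝ) ≤ (c.den : ℝ) ^ e := by
      exact_mod_cast Nat.le_of_dvd (pow_pos c.den_pos e) hden
    refine (mul_le_mul habs hden' (by positivity) (by positivity)).trans ?_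
    rw [← mul_pow]
    exact pow_le_pow_right₀ hTq (by omega)
  rcases eq_or_ne x.num 0 with h0 | h0
  · rw [h0]
    have := Real.log_nonneg hTq
    simp only [Int.cast_zero, abs_zero, Real.log_zero]
    positivity
  · have := Real.log_le_log (abs_pos.2 (by exact_mod_cast h0)) hle
    rw [Real.log_pow] at this
    push_cast at this
    linarith

theorem gcIter_ne_zero_of_mem_Sg {g : ℤ[X]} {c : ℚ} (hc : c ∈ Sg g) {n : ℕ} (hn : 1 ≤ n) :
    gcIter g c n ≠ 0 := by
  intro h
  refine hc (((Finset.range n).finite_toSet.image fun m => gcIter g c m).subset ?_)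
  rintro _ ⟨m, rfl⟩
  refine ⟨(m + 1) % n, by simpa using Nat.mod_lt _ hn, ?_⟩
  exact Function.IsPeriodicPt.iterate_mod_apply h (m + 1)

/-- An infinite orbit is unbounded in the real or in some `p`-adic absolute value. -/
theorem exists_unbounded_of_mem_Sg {g : ℤ[X]} {c : ℚ} (hd : 2 ≤ g.natDegree)
    (hc : c ∈ Sg g) {M : ℝ} (hM : ∀ n, |(gcIter g c n : ℝ)| ≤ M) :
    ∃ (p : ℕ) (_ : Fact p.Prime), ∀ R : ℝ, ∃ n,
      R < Rat.AbsoluteValue.padic p (gcIter g c n) := by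
  by_contra! hcon
  obtain ⟨T, -, h⟩ := exists_pow_bounds_iterate g c hd
  have hbd : ∀ p : ℕ, ∃ R : ℝ, 1 ≤ R ∧ (p.Prime → ∀ n, p ∣ (gcIter g c n).den →
      ((p ^ (gcIter g c n).den.factorization p : ℕ) : ℝ) ≤ R) := by
    intro p
    by_cases hp : p.Prime
    · have : Fact p.Prime := ⟨hp⟩
      obtain ⟨R, hR⟩ := hcon p this
      refine ⟨max 1 R, le_max_left _ _, fun _ n hn => ?_⟩
      rw [Rat.pow_factorization_den_eq_padic p _ hn]
      exact (hR n).trans (le_max_right _ _)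
    · exact ⟨1, le_rfl, fun h => absurd h hp⟩
  choose R hR1 hR using hbd
  have hden : ∀ n, ((gcIter g c n).den : ℝ) ≤ ∏ p ∈ c.den.primeFactors, R p := by
    intro n
    obtain ⟨e, -, -, he⟩ := h n
    have hsub : (gcIter g c n).den.primeFactors ⊆ c.den.primeFactors :=
      fun p hp => Nat.mem_primeFactors.2 ⟨Nat.prime_of_mem_primeFactors hp,
        (Nat.prime_of_mem_primeFactors hp).dvd_of_dvd_pow
          ((Nat.dvd_of_mem_primeFactors hp).trans he), c.den_nz⟩
    refine le_trans ?_ (Finset.prod_le_prod_of_subset_of_one_le hsub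
      (fun p _ => by linarith [hR1 p]) fun p _ _ => hR1 p)
    conv_lhs => rw [← Nat.prod_factorization_pow_eq_self (gcIter g c n).den_nz]
    rw [Finsupp.prod, Nat.support_factorization, Nat.cast_prod]
    exact Finset.prod_le_prod (fun _ _ => by positivity) fun p hp =>
      hR p (Nat.prime_of_mem_primeFactors hp) n (Nat.dvd_of_mem_primeFactors hp)
  refine hc ((Rat.finite_abs_le_den_le M ⌊∏ p ∈ c.den.primeFactors, R p⌋₊).subset ?_)
  rintro _ ⟨m, rfl⟩
  exact ⟨hM _, Nat.le_floor (hden _)⟩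

theorem exists_le_log_abs_num {g : ℤ[X]} {c : ℚ} (hd : 2 ≤ g.natDegree)
    (h1 : g.coeff 1 = 0) (hc : c ∈ Sg g) :
    ∃ κ L : ℝ, 0 < κ ∧ 0 ≤ L ∧ ∀ᶠ n : ℕ in atTop,
      κ * ((g.natDegree - 1 : ℕ) : ℝ) ^ n ≤
        Real.log |((gcIter g c n).num : ℝ)| + n * L := by
  set P : ℚ[X] := g.map (Int.castRingHom ℚ) + C c
  have hPd : P.natDegree = g.natDegree := by
    rw [natDegree_add_C, natDegree_map_eq_of_injective (RingHom.injective_int _)]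
  have hPit : ∀ n, (fun x => P.eval x)^[n] 0 = gcIter g c n := by
    intro n; simp [P, gcIter]
  have hnum : ∀ x : ℚ, (x.num : ℝ) = x * x.den := fun x => by
    exact_mod_cast (Rat.mul_den_eq_num x).symm
  have growth := fun v : AbsoluteValue ℚ ℝ => v.exists_growth_of_unbounded P (by omega)
  simp only [hPit, hPd] at growth
  by_cases hreal : ∀ R : ℝ, ∃ n, R < Rat.AbsoluteValue.real (gcIter g c n)
  · obtain ⟨κ, hκ, h⟩ := growth _ hreal
    refine ⟨κ, 0, hκ, le_rfl, h.mono fun n hn => hn.trans ?_⟩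
    rw [Rat.AbsoluteValue.real_eq_abs, mul_zero, add_zero]
    push_cast
    rcases eq_or_ne (gcIter g c n) 0 with h0 | h0
    · simp [h0]
    · have : (0 : ℝ) < |(gcIter g c n : ℝ)| := abs_pos.2 (by exact_mod_cast h0)
      refine Real.log_le_log this ?_
      rw [hnum, abs_mul, Nat.abs_cast]
      exact le_mul_of_one_le_right this.le (by exact_mod_cast (gcIter g c n).den_pos)
  · push Not at hreal
    obtain ⟨M, hM⟩ := hreal
    simp only [Rat.AbsoluteValue.real_eq_abs] at hM
    push_cast at hM
    obtain ⟨p, _, hp⟩ := exists_unbounded_of_mem_Sg hd hc hM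
    obtain ⟨κ, hκ, h⟩ := growth _ hp
    have hRit : ∀ n, (fun x => (P.map (Rat.castHom ℝ)).eval x)^[n] 0 = (gcIter g c n : ℝ) := by
      intro n
      induction n with
      | zero => simp [gcIter]
      | succ n ih =>
        rw [Function.iterate_succ_apply', ih, ← hPit (n + 1), Function.iterate_succ_apply',
          hPit]
        exact eval_map_apply (Rat.castHom ℝ) _
    obtain ⟨Λ, hΛ, hsmall⟩ := eventually_lt_abs_iterate_of_bounded
      (P.map (Rat.castHom ℝ)) (M := M) (by simp [P, h1])
      (fun n => by rw [hRit]; exact hM n)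
      (fun n hn => by rw [hRit]; exact_mod_cast gcIter_ne_zero_of_mem_Sg hc hn)
    simp only [hRit] at hsmall
    have hlogΛ : 0 ≤ Real.log Λ := Real.log_nonneg (by linarith)
    have hlog4 : 0 ≤ Real.log 4 := Real.log_nonneg (by norm_num)
    refine ⟨κ, Real.log Λ + Real.log 4, hκ, by positivity, ?_⟩
    filter_upwards [h, hsmall, eventually_ge_atTop 1] with n hn hs hn1
    set x := gcIter g c n
    have hx0 : x ≠ 0 := gcIter_ne_zero_of_mem_Sg hc hn1
    have hxabs : (0 : ℝ) < |(x : ℝ)| := abs_pos.2 (by exact_mod_cast hx0)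
    have hden : (0 : ℝ) < x.den := by exact_mod_cast x.den_pos
    have hΛ0 : Λ ≠ 0 := by linarith
    have e1 := Real.log_le_log (AbsoluteValue.pos _ hx0) (Rat.padic_le_den p x)
    have e2 := Real.log_le_log (by positivity) hs.le
    rw [Real.log_div (by positivity) (by norm_num), Real.log_inv, Real.log_pow] at e2
    rw [hnum, abs_mul, Nat.abs_cast, Real.log_mul hxabs.ne' hden.ne', mul_add]
    have : Real.log 4 ≤ n * Real.log 4 :=
      le_mul_of_one_le_left hlog4 (by exact_mod_cast hn1)
    linarith

theorem Nat.eventually_mul_pow_lt_mul_succ_pow (d : ℕ) {κ C : ℝ} (hκ : 0 < κ) :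
    ∀ᶠ m : ℕ in atTop, (2 * m + 2) * C * (d : ℝ) ^ m < κ * (d + 1 : ℝ) ^ m := by
  have hr0 : (0 : ℝ) ≤ d / (d + 1) := by positivity
  have hr1 : (d : ℝ) / (d + 1) < 1 := by rw [div_lt_one (by positivity)]; linarith
  have h : Tendsto (fun m : ℕ => 2 * C * (m * ((d : ℝ) / (d + 1)) ^ m) +
      2 * C * ((d : ℝ) / (d + 1)) ^ m) atTop (𝓝 (2 * C * 0 + 2 * C * 0)) :=
    ((tendsto_self_mul_const_pow_of_lt_one hr0 hr1).const_mul _).add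
      ((tendsto_pow_atTop_nhds_zero_of_lt_one hr0 hr1).const_mul _)
  rw [mul_zero, add_zero] at h
  filter_upwards [h.eventually_lt_const hκ] with m hm
  have hpos : (0 : ℝ) < (d + 1 : ℝ) ^ m := by positivity
  have := mul_lt_mul_of_pos_right hm hpos
  refine lt_of_eq_of_lt ?_ this
  rw [div_pow]
  field_simp

theorem eventually_sum_log_An_lt {g : ℤ[X]} {c : ℚ} (hd : 3 ≤ g.natDegree)
    (h1 : g.coeff 1 = 0) (hc : c ∈ Sg g) :
    ∀ᶠ n : ℕ in atTop, (∑ p ∈ n.primeFactors, Real.log |(An g c (n / p) : ℝ)|) <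
        Real.log |(An g c n : ℝ)| := by
  obtain ⟨K, hK, hup⟩ := exists_log_abs_num_le g c (by omega)
  obtain ⟨κ, L, hκ, hL, hlow⟩ := exists_le_log_abs_num (by omega) h1 hc
  set d := g.natDegree
  have hhalf : Tendsto (fun n : ℕ => n / 2) atTop atTop :=
    Nat.tendsto_div_const_atTop (by norm_num)
  filter_upwards [(tendsto_add_atTop_nat 1).eventually hlow,
    hhalf.eventually (Nat.eventually_mul_pow_lt_mul_succ_pow d (C := K * d + L) hκ)]
    with n hn hm
  have hd1 : (1 : ℝ) ≤ d := by exact_mod_cast (by omega : 1 ≤ d)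
  set m := n / 2
  have hsum : (∑ p ∈ n.primeFactors, Real.log |(An g c (n / p) : ℝ)|) ≤
      n * (K * (d : ℝ) ^ (m + 1)) := by
    have hcard : (n.primeFactors.card : ℝ) ≤ n := by
      have : n.primeFactors ⊆ Finset.Icc 1 n := fun p hp => Finset.mem_Icc.2
        ⟨(Nat.prime_of_mem_primeFactors hp).one_lt.le, Nat.le_of_mem_primeFactors hp⟩
      exact_mod_cast (Finset.card_le_card this).trans_eq (by simp)
    refine (Finset.sum_le_card_nsmul _ _ (K * (d : ℝ) ^ (m + 1)) fun p hp => ?_).trans ?_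
    · refine (hup _).trans (mul_le_mul_of_nonneg_left (pow_le_pow_right₀ hd1 ?_) hK)
      exact Nat.succ_le_succ
        (Nat.div_le_div_left (Nat.prime_of_mem_primeFactors hp).two_le (by norm_num))
    · rw [nsmul_eq_mul]
      exact mul_le_mul_of_nonneg_right hcard (by positivity)
  have hs : (d + 1 : ℝ) ^ m ≤ ((d - 1 : ℕ) : ℝ) ^ (n + 1) := by
    obtain ⟨s, hs⟩ : ∃ s, d = s + 1 := ⟨d - 1, by omega⟩
    have hs2 : (2 : ℝ) ≤ s := by exact_mod_cast (by omega : 2 ≤ s)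
    rw [hs, Nat.add_sub_cancel]
    calc ((s + 1 : ℕ) + 1 : ℝ) ^ m ≤ ((s : ℝ) ^ 2) ^ m := by
          refine pow_le_pow_left₀ (by positivity) ?_ m
          push_cast
          nlinarith
      _ = (s : ℝ) ^ (2 * m) := by rw [pow_mul]
      _ ≤ _ := pow_le_pow_right₀ (by linarith) (by omega)
  have hn2 : (n : ℝ) + 1 ≤ 2 * m + 2 := by exact_mod_cast (by omega : n + 1 ≤ 2 * m + 2)
  have hdm : (1 : ℝ) ≤ (d : ℝ) ^ m := one_le_pow₀ hd1
  have hfin : (n : ℝ) * (K * (d : ℝ) ^ (m + 1)) + (n + 1) * L ≤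
      (2 * m + 2) * (K * d + L) * (d : ℝ) ^ m := by
    have e1 : (n : ℝ) * (K * (d : ℝ) ^ (m + 1)) ≤ (2 * m + 2) * (K * (d : ℝ) ^ (m + 1)) :=
      mul_le_mul_of_nonneg_right (by linarith) (by positivity)
    have e2 : ((n : ℝ) + 1) * L ≤ (2 * m + 2) * (L * (d : ℝ) ^ m) :=
      mul_le_mul hn2 (le_mul_of_one_le_right hL hdm) hL (by positivity)
    refine (add_le_add e1 e2).trans_eq ?_
    ring
  have := mul_le_mul_of_nonneg_left hs hκ.le
  push_cast at hn
  unfold An at hsum ⊢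
  linarith

theorem Ug0_finite (g : ℤ[X]) (hg : g ≠ 0) : (Ug0 g).Finite := by
  refine (Rat.finite_abs_le_den_le (4 * Lg g) g.leadingCoeff.natAbs).subset ?_
  rintro c ⟨-, h, hden⟩
  exact ⟨h, Nat.le_of_dvd (Int.natAbs_pos.2 (leadingCoeff_ne_zero.2 hg))
    (Int.natCast_dvd.1 hden)⟩

/-- Proposition 3.8: every `x²`-divisible `g ∈ ℤ[x]` of degree `d ≥ 3` has rapidly
increasing numerators on the finite set `𝕌_g⁰`. -/
theorem rapidly_increasing_numerators_Ug0 (g : ℤ[X]) (hg : IsX2Divisible g)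
    (hd : 3 ≤ g.natDegree) :
    RapidlyIncreasingNumerators g (Ug0 g) := by
  have hfin := Ug0_finite g (by rintro rfl; simp at hd)
  have key : ∀ c ∈ Ug0 g, ∃ N, ∀ n ≥ N,
      (∑ p ∈ n.primeFactors, Real.log |(An g c (n / p) : ℝ)|) < Real.log |(An g c n : ℝ)| :=
    fun c hc => eventually_atTop.1 (eventually_sum_log_An_lt hd hg.2.2 hc.1)
  choose! N hN using key
  refine ⟨hfin.toFinset.sup N + 1, Nat.succ_pos _, fun c hc => ⟨Finset.range (N c), ?_, ?_⟩⟩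
  · rw [Finset.card_range]
    exact (Finset.le_sup (hfin.mem_toFinset.2 hc)).trans (Nat.le_succ _)
  · intro n _ hn
    exact hN c hc n (by simpa using hn)
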